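/- Let (X_t)_{t∈ℤ} be a stationary F-valued process and λ, b : F → [0,∞) measurable with 𝔼[log⁺ λ(X_0)] < ∞, 𝔼[log⁺ b(X_0)] < ∞ and limsup_n (∏_{i=1}^n λ(X_{-i}))^{1/n} < 1 almost surely. Then almost surely there exists a positive integer C such that sup_{j ≥ C} ∏_{i=1}^j λ(X_{-i}) ≤ 1 − 1/C and b(X_{-1}) + Σ_{i ≥ 2} (∏_{k=1}^{i-1} λ(X_{-k})) b(X_{-i}) ≤ C; in particular the random series b(X_{-1}) + Σ_{i ≥ 2} (∏_{k=1}^{i-1} λ(X_{-k})) b(X_{-i}) converges almost surely. -/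

import Mathlib

open MeasureTheory ProbabilityTheory Filter
open scoped ENNReal

noncomputable section

/-- The shift operator on two-sided paths. -/
def zshift {α : Type*} (x : ℤ → α) : ℤ → α := fun t => x (t + 1)

/-- Running maximum of the Birkhoff sums `S_0, ..., S_n` of `f`. -/
def runMax {Y : Type*} (T : Y → Y) (f : Y → ℝ) : ℕ → Y → ℝ
  | 0 => fun _ => 0
  | n + 1 => fun x => max 0 (f x + runMax T f n (T x))

theorem runMax_nonneg {Y : Type*} (T : Y → Y) (f : Y → ℝ) (n : ℕ) (x : Y) :
    0 ≤ runMax T f n x := by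
  cases n with
  | zero => exact le_rfl
  | succ n => exact le_max_left _ _

theorem runMax_mono {Y : Type*} (T : Y → Y) (f : Y → ℝ) (n : ℕ) :
    ∀ x, runMax T f n x ≤ runMax T f (n + 1) x := by
  induction n with
  | zero => intro x; exact runMax_nonneg T f 1 x
  | succ n ih =>
    intro x
    have := ih (T x)
    change max 0 (f x + runMax T f n (T x)) ≤ max 0 (f x + runMax T f (n + 1) (T x))
    gcongr

theorem sum_le_runMax {Y : Type*} (T : Y → Y) (f : Y → ℝ) (n : ℕ) :
    ∀ x, ∑ i ∈ Finset.range n, f (T^[i] x) ≤ runMax T f n x := by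
  induction n with
  | zero => intro x; simp [runMax]
  | succ n ih =>
    intro x
    rw [Finset.sum_range_succ']
    have := ih (T x)
    simp only [Function.iterate_succ, Function.comp, Function.iterate_zero, id] at this ⊢
    refine le_trans ?_ (le_max_right _ _)
    linarith

theorem runMax_measurable {Y : Type*} [MeasurableSpace Y] {T : Y → Y} {f : Y → ℝ}
    (hT : Measurable T) (hf : Measurable f) (n : ℕ) : Measurable (runMax T f n) := by
  induction n with
  | zero => exact measurable_const
  | succ n ih => exact measurable_const.max (hf.add (ih.comp hT))

theorem runMax_integrable {Y : Type*} [MeasurableSpace Y] {μ : Measure Y} [IsProbabilityMeasure μ]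
    {T : Y → Y} {f : Y → ℝ}
    (hT : MeasurePreserving T μ μ) (hf : Integrable f μ) (n : ℕ) :
    Integrable (runMax T f n) μ := by
  induction n with
  | zero => exact integrable_zero _ _ _
  | succ n ih =>
    exact (integrable_zero _ _ _).sup (hf.add (hT.integrable_comp_of_integrable ih))

theorem maximal_ergodic {Y : Type*} [MeasurableSpace Y] {μ : Measure Y} [IsProbabilityMeasure μ]
    {T : Y → Y} {f : Y → ℝ}
    (hT : MeasurePreserving T μ μ) (hfm : Measurable f) (hf : Integrable f μ) (n : ℕ) :
    0 ≤ ∫ x in {x | 0 < runMax T f n x}, f x ∂μ := by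
  set A := {x | 0 < runMax T f n x} with hA
  have hAm : MeasurableSet A := measurableSet_lt measurable_const
    (runMax_measurable hT.measurable hfm n)
  cases n with
  | zero => simp [hA, runMax]
  | succ n =>
    have h1 := runMax_integrable hT hf n
    have h2 := runMax_integrable hT hf (n + 1)
    have h1T : Integrable (fun x => runMax T f n (T x)) μ := hT.integrable_comp_of_integrable h1
    have e1 : ∫ x, runMax T f (n + 1) x ∂μ ≤ ∫ x, (A.indicator f x + runMax T f n (T x)) ∂μ := by
      refine integral_mono h2 ((hf.indicator hAm).add h1T) fun x => ?_
      by_cases hx : x ∈ A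
      · simp only [Set.indicator_of_mem hx]
        have hx' : 0 < max 0 (f x + runMax T f n (T x)) := hx
        change max 0 (f x + runMax T f n (T x)) ≤ _
        rcases lt_max_iff.1 hx' with h | h
        · exact absurd h (lt_irrefl _)
        · exact (max_eq_right h.le).le
      · simp only [Set.indicator_of_notMem hx, zero_add]
        exact (not_lt.1 hx).trans (runMax_nonneg _ _ _ _)
    rw [integral_add (hf.indicator hAm) h1T, integral_indicator hAm] at e1
    have e2 : ∫ x, runMax T f n (T x) ∂μ = ∫ x, runMax T f n x ∂μ := by
      conv_rhs => rw [← hT.map_eq]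
      rw [integral_map hT.measurable.aemeasurable]
      exact (runMax_measurable hT.measurable hfm n).aestronglyMeasurable
    have e3 : ∫ x, runMax T f n x ∂μ ≤ ∫ x, runMax T f (n + 1) x ∂μ :=
      integral_mono h1 h2 (runMax_mono T f n)
    linarith

theorem ae_bdd_averages {Y : Type*} [MeasurableSpace Y] {μ : Measure Y} [IsProbabilityMeasure μ]
    {T : Y → Y} {g : Y → ℝ} (hT : MeasurePreserving T μ μ) (hgm : Measurable g)
    (hg : Integrable g μ) (hg0 : ∀ x, 0 ≤ g x) :
    ∀ᵐ x ∂μ, ∃ t : ℕ, ∀ n : ℕ, ∑ i ∈ Finset.range n, g (T^[i] x) ≤ t * n := by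
  set G := ∫ x, g x ∂μ with hG
  have hG0 : 0 ≤ G := integral_nonneg hg0
  have key : ∀ t : ℕ, 0 < t →
      μ {x | ∃ n, 0 < runMax T (fun x => g x - t) n x} ≤ ENNReal.ofReal (G / t) := by
    intro t ht
    have ht' : (0 : ℝ) < t := by exact_mod_cast ht
    have hu : {x | ∃ n, 0 < runMax T (fun x => g x - t) n x}
        = ⋃ n, {x | 0 < runMax T (fun x => g x - t) n x} := by
      ext; simp
    have hmono : Monotone fun n => {x | 0 < runMax T (fun x => g x - t) n x} :=
      monotone_nat_of_le_succ fun n x hx => lt_of_lt_of_le hx (runMax_mono _ _ _ _)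
    rw [hu, hmono.measure_iUnion]
    refine iSup_le fun n => ?_
    have hI : Integrable (fun x => g x - (t : ℝ)) μ := hg.sub (integrable_const _)
    have := maximal_ergodic hT (hgm.sub_const (t : ℝ)) hI n
    rw [integral_sub hg.integrableOn (integrable_const _).integrableOn, setIntegral_const,
      smul_eq_mul] at this
    have h2 := setIntegral_le_integral (s := {x | 0 < runMax T (fun x => g x - t) n x}) hg
      (Eventually.of_forall hg0)
    rw [← ofReal_measureReal]
    apply ENNReal.ofReal_le_ofReal
    rw [le_div_iff₀ ht']
    linarith
  have hz : μ {x | ∀ t : ℕ, ∃ n, 0 < runMax T (fun x => g x - t) n x} = 0 := by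
    have hlim : Tendsto (fun t : ℕ => ENNReal.ofReal (G / t)) atTop (nhds 0) := by
      rw [← ENNReal.ofReal_zero]
      exact ENNReal.tendsto_ofReal (tendsto_const_div_atTop_nhds_zero_nat G)
    refine le_antisymm (ge_of_tendsto hlim ?_) bot_le
    filter_upwards [eventually_gt_atTop 0] with t ht
    refine le_trans (measure_mono ?_) (key t ht)
    intro x hx
    exact hx t
  have : ∀ᵐ x ∂μ, ¬ ∀ t : ℕ, ∃ n, 0 < runMax T (fun x => g x - t) n x := by
    rw [ae_iff]; simpa using hz
  filter_upwards [this] with x hx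
  push Not at hx
  obtain ⟨t, ht⟩ := hx
  refine ⟨t, fun n => ?_⟩
  have h := (sum_le_runMax T (fun x => g x - t) n x).trans (ht n)
  simp only [Finset.sum_sub_distrib, Finset.sum_const, Finset.card_range, nsmul_eq_mul] at h
  linarith

theorem ae_small_iterates {Y : Type*} [MeasurableSpace Y] {μ : Measure Y} [IsProbabilityMeasure μ]
    {T : Y → Y} {g : Y → ℝ} (hT : MeasurePreserving T μ μ) (hgm : Measurable g)
    (hg : Integrable g μ) (hg0 : ∀ x, 0 ≤ g x) :
    ∀ᵐ x ∂μ, ∀ k : ℕ, ∀ᶠ n : ℕ in atTop, (k + 1 : ℝ) * g (T^[n] x) ≤ n := by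
  rw [ae_all_iff]
  intro k
  have h1 : Integrable (fun x => (k + 1 : ℝ) * g x) μ := hg.const_mul _
  have h2 : (∑' j : ℕ, μ {x | (k + 1 : ℝ) * g x ∈ Set.Ioi (j : ℝ)}) < ∞ := by
    letI : MeasureSpace Y := ⟨μ⟩
    haveI : IsProbabilityMeasure (volume : Measure Y) := ‹IsProbabilityMeasure μ›
    exact tsum_prob_mem_Ioi_lt_top (Ω := Y) h1
      (fun x => mul_nonneg (by positivity) (hg0 x))
  have h3 : (∑' j : ℕ, μ {x | (k + 1 : ℝ) * g (T^[j] x) ∈ Set.Ioi (j : ℝ)}) ≠ ∞ := by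
    convert h2.ne using 3 with j
    exact (hT.iterate j).measure_preimage
      ((measurable_const.mul hgm) measurableSet_Ioi).nullMeasurableSet
  filter_upwards [ae_eventually_notMem h3] with x hx
  filter_upwards [hx] with n hn
  simpa using hn

theorem deterministic_part (p c : ℕ → ℝ) (b0 : ℝ) (t : ℕ) (hp : ∀ n, 0 ≤ p n) (hc : ∀ n, 0 ≤ c n)
    (hpt : ∀ n, p n ≤ Real.exp (t * n))
    (hl : atTop.limsup (fun n : ℕ => p n ^ ((n : ℝ)⁻¹)) < 1)
    (hce : ∀ k : ℕ, ∀ᶠ n : ℕ in atTop, c n ≤ Real.exp (n / (k + 1 : ℝ))) :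
    (∃ C : ℕ, 0 < C ∧ (∀ j : ℕ, C ≤ j → p j ≤ 1 - 1 / (C : ℝ)) ∧
      ENNReal.ofReal b0 + ∑' m : ℕ, ENNReal.ofReal (p (m + 1)) * ENNReal.ofReal (c m)
        ≤ (C : ℝ≥0∞)) ∧
      ENNReal.ofReal b0 + ∑' m : ℕ, ENNReal.ofReal (p (m + 1)) * ENNReal.ofReal (c m) < ∞ := by
  have hbdd : IsBoundedUnder (· ≤ ·) atTop (fun n : ℕ => p n ^ ((n : ℝ)⁻¹)) := by
    refine ⟨Real.exp t, ?_⟩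
    rw [eventually_map]
    filter_upwards [eventually_gt_atTop 0] with n hn
    have hn' : (n : ℝ) ≠ 0 := by positivity
    calc p n ^ ((n : ℝ)⁻¹) ≤ (Real.exp (t * n)) ^ ((n : ℝ)⁻¹) :=
          Real.rpow_le_rpow (hp n) (hpt n) (by positivity)
      _ = Real.exp t := by
          rw [← Real.exp_mul]; congr 1; field_simp
  obtain ⟨r, hr, hr1⟩ := exists_between hl
  have hev0 := eventually_lt_of_limsup_lt hr hbdd
  have hev : ∀ᶠ n : ℕ in atTop, 0 < r ∧ p n ≤ r ^ n := by
    filter_upwards [hev0, eventually_gt_atTop 0] with n h hn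
    have h0 := Real.rpow_nonneg (hp n) ((n : ℝ)⁻¹)
    refine ⟨h0.trans_lt h, ?_⟩
    rw [← Real.rpow_inv_natCast_pow (hp n) hn.ne']
    exact pow_le_pow_left₀ h0 h.le n
  have hr0 : 0 < r := hev.exists.choose_spec.1
  obtain ⟨k, hk⟩ := exists_nat_one_div_lt (neg_pos.2 (Real.log_neg hr0 hr1))
  set q := r * Real.exp (1 / (k + 1 : ℝ)) with hq
  have hq0 : 0 ≤ q := by positivity
  have hq1 : q < 1 := by
    rw [hq, ← Real.exp_log hr0, ← Real.exp_add, Real.exp_lt_one_iff]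
    linarith
  have hsum : Summable fun m => p (m + 1) * c m := by
    refine Summable.of_norm_bounded_eventually_nat (g := fun m => q ^ m)
      (summable_geometric_of_lt_one hq0 hq1) ?_
    filter_upwards [(tendsto_add_atTop_nat 1).eventually hev, hce k] with m h1 h2
    rw [Real.norm_of_nonneg (mul_nonneg (hp _) (hc _)), hq, mul_pow, ← Real.exp_nat_mul]
    refine mul_le_mul (h1.2.trans ?_) (h2.trans_eq ?_) (hc _) (by positivity)
    · exact pow_le_pow_of_le_one hr0.le hr1.le (Nat.le_succ m)
    · congr 1; ring
  have hfin : ENNReal.ofReal b0 + ∑' m : ℕ, ENNReal.ofReal (p (m + 1)) * ENNReal.ofReal (c m)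
      < ∞ := by
    simp_rw [← fun m => ENNReal.ofReal_mul (q := c m) (hp (m + 1))]
    rw [← ENNReal.ofReal_tsum_of_nonneg (fun m => mul_nonneg (hp _) (hc _)) hsum]
    exact ENNReal.add_lt_top.2 ⟨ENNReal.ofReal_lt_top, ENNReal.ofReal_lt_top⟩
  refine ⟨?_, hfin⟩
  obtain ⟨C1, hC1⟩ := ENNReal.exists_nat_gt hfin.ne
  have hhalf : ∀ᶠ n : ℕ in atTop, p n ≤ 1 / 2 := by
    filter_upwards [hev, (tendsto_pow_atTop_nhds_zero_of_lt_one hr0.le hr1).eventually_le_const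
      (show (0 : ℝ) < 1 / 2 by norm_num)] with n h1 h2
    exact h1.2.trans h2
  obtain ⟨N, hN⟩ := eventually_atTop.1 hhalf
  refine ⟨max (max C1 N) 2, by positivity, fun j hj => ?_, hC1.le.trans ?_⟩
  · refine (hN j (by omega)).trans ?_
    have : (2 : ℝ) ≤ ((max (max C1 N) 2 : ℕ) : ℝ) := by exact_mod_cast le_max_right _ _
    have := one_div_le_one_div_of_le (by norm_num) this
    linarith
  · exact_mod_cast (le_max_left C1 N).trans (le_max_left _ _)

theorem lintegral_integrable {Ω : Type*} [MeasurableSpace Ω] {μ : Measure Ω} {f : Ω → ℝ}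
    (hf : Measurable f) (h0 : ∀ x, 0 ≤ f x) (h : ∫⁻ x, ENNReal.ofReal (f x) ∂μ < ∞) :
    Integrable f μ :=
  ⟨hf.aestronglyMeasurable, by
    rwa [hasFiniteIntegral_iff_ofReal (Eventually.of_forall h0)]⟩

theorem stabilization_and_series_convergence
    {F : Type*} [MeasurableSpace F] [TopologicalSpace F] [PolishSpace F] [BorelSpace F]
    {Ω : Type*} [MeasurableSpace Ω] (Pr : Measure Ω) [IsProbabilityMeasure Pr]
    (X : ℤ → Ω → F) (hX : ∀ t, Measurable (X t))
    -- the process X is stationary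
    (hstat : (Pr.map fun ω => fun t => X t ω).map zshift = Pr.map fun ω => fun t => X t ω)
    (lam b : F → ℝ) (hlam : Measurable lam) (hb : Measurable b)
    (hlam0 : ∀ x, 0 ≤ lam x) (hb0 : ∀ x, 0 ≤ b x)
    -- log⁺ moments
    (hlamlog : ∫⁻ ω, ENNReal.ofReal (Real.log (max (lam (X 0 ω)) 1)) ∂Pr < ∞)
    (hblog : ∫⁻ ω, ENNReal.ofReal (Real.log (max (b (X 0 ω)) 1)) ∂Pr < ∞)
    -- the almost sure Lyapunov condition
    (hlyap : ∀ᵐ ω ∂Pr, atTop.limsup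
      (fun n : ℕ => (∏ i ∈ Finset.range n, lam (X (-(i : ℤ) - 1) ω)) ^ ((n : ℝ)⁻¹)) < 1) :
    ∀ᵐ ω ∂Pr,
      (∃ C : ℕ, 0 < C ∧
        (∀ j : ℕ, C ≤ j → ∏ i ∈ Finset.range j, lam (X (-(i : ℤ) - 1) ω) ≤ 1 - 1 / (C : ℝ)) ∧
        ENNReal.ofReal (b (X (-1) ω)) +
            ∑' m : ℕ, (∏ k ∈ Finset.range (m + 1), ENNReal.ofReal (lam (X (-(k : ℤ) - 1) ω))) *
              ENNReal.ofReal (b (X (-(m : ℤ) - 2) ω)) ≤ (C : ℝ≥0∞)) ∧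
      -- in particular, the random series converges almost surely
      ENNReal.ofReal (b (X (-1) ω)) +
          ∑' m : ℕ, (∏ k ∈ Finset.range (m + 1), ENNReal.ofReal (lam (X (-(k : ℤ) - 1) ω))) *
            ENNReal.ofReal (b (X (-(m : ℤ) - 2) ω)) < ∞ := by
  classical
  set path : Ω → ℤ → F := fun ω t => X t ω with hpath
  have hpm : Measurable path := measurable_pi_lambda _ hX
  set μ := Pr.map path with hμ
  haveI : IsProbabilityMeasure μ := Measure.isProbabilityMeasure_map hpm.aemeasurable
  let T : (ℤ → F) → ℤ → F := fun x t => x (t - 1)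
  have hTm : Measurable T := measurable_pi_lambda _ fun t => measurable_pi_apply _
  have hzm : Measurable (zshift : (ℤ → F) → ℤ → F) :=
    measurable_pi_lambda _ fun t => measurable_pi_apply _
  have hT : MeasurePreserving T μ μ := by
    refine ⟨hTm, ?_⟩
    conv_lhs => rw [← hstat]
    rw [Measure.map_map hTm hzm]
    have : T ∘ zshift = id := by
      funext x t; simp [T, zshift]
    rw [this, Measure.map_id]
  have hTi : ∀ (n : ℕ) (x : ℤ → F) (s : ℤ), T^[n] x s = x (s - n) := by
    intro n
    induction n with
    | zero => intro x s; simp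
    | succ n ih =>
      intro x s
      rw [Function.iterate_succ_apply, ih]
      simp only [T]
      congr 1; push_cast; ring
  have gen : ∀ (u : F → ℝ), Measurable u →
      ∫⁻ ω, ENNReal.ofReal (Real.log (max (u (X 0 ω)) 1)) ∂Pr < ∞ → ∀ s : ℕ,
      Measurable (fun x : ℤ → F => Real.log (max (u (x (-(s : ℤ)))) 1)) ∧
      Integrable (fun x : ℤ → F => Real.log (max (u (x (-(s : ℤ)))) 1)) μ := by
    intro u hu hul s
    have hm : ∀ s : ℤ, Measurable (fun x : ℤ → F => Real.log (max (u (x s)) 1)) := fun s =>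
      Real.measurable_log.comp ((hu.comp (measurable_pi_apply s)).max measurable_const)
    refine ⟨hm _, ?_⟩
    have h0 : Integrable (fun x : ℤ → F => Real.log (max (u (x 0)) 1)) μ := by
      refine lintegral_integrable (hm 0) (fun x => Real.log_nonneg (le_max_right _ _)) ?_
      rw [hμ, lintegral_map (hm 0).ennreal_ofReal hpm]
      exact hul
    have := (hT.iterate s).integrable_comp_of_integrable h0
    convert this using 2 with x
    simp only [Function.comp, hTi, zero_sub]
  obtain ⟨hl1, hl2⟩ := gen lam hlam hlamlog 1
  obtain ⟨hb1, hb2⟩ := gen b hb hblog 2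
  have A := ae_of_ae_map hpm.aemeasurable
    (ae_bdd_averages hT hl1 hl2 fun x => Real.log_nonneg (le_max_right _ _))
  have B := ae_of_ae_map hpm.aemeasurable
    (ae_small_iterates hT hb1 hb2 fun x => Real.log_nonneg (le_max_right _ _))
  filter_upwards [hlyap, A, B] with ω h1 ⟨t, h2⟩ h3
  have e1 : ∀ i : ℕ, T^[i] (path ω) (-((1 : ℕ) : ℤ)) = X (-(i : ℤ) - 1) ω := by
    intro i; rw [hTi, hpath]; dsimp only; congr 1; push_cast; ring
  have e2 : ∀ i : ℕ, T^[i] (path ω) (-((2 : ℕ) : ℤ)) = X (-(i : ℤ) - 2) ω := by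
    intro i; rw [hTi, hpath]; dsimp only; congr 1; push_cast; ring
  simp only [e1] at h2
  simp only [e2] at h3
  have main := deterministic_part (fun n => ∏ i ∈ Finset.range n, lam (X (-(i : ℤ) - 1) ω))
    (fun m => b (X (-(m : ℤ) - 2) ω)) (b (X (-1) ω)) t
    (fun n => Finset.prod_nonneg fun i _ => hlam0 _) (fun m => hb0 _) ?_ h1 ?_
  · simp only [ENNReal.ofReal_prod_of_nonneg (fun i _ => hlam0 _)] at main
    exact main
  · intro n
    refine le_trans ?_ (Real.exp_le_exp.2 (h2 n))
    rw [Real.exp_sum]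
    refine Finset.prod_le_prod (fun i _ => hlam0 _) fun i _ => ?_
    rw [Real.exp_log (by positivity)]
    exact le_max_left _ _
  · intro k
    filter_upwards [h3 k] with n hn
    have : Real.log (max (b (X (-(n : ℤ) - 2) ω)) 1) ≤ n / (k + 1 : ℝ) := by
      rw [le_div_iff₀ (by positivity)]; linarith
    refine le_trans ?_ (Real.exp_le_exp.2 this)
    rw [Real.exp_log (by positivity)]
    exact le_max_left _ _

end
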